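/- arXiv:0901.1620 — 3 statements merged into one kernel-verified Lean document; each statement's English description precedes it below -/
import Mathlib

section
/- For any probability measure ν on the circle 𝕋 = ℝ/2πℤ, any positive integer n₀, and any arc A ⊂ 𝕋, one has |ν(A) - mes(A)/(2π)| ≤ K·(1/n₀ + Σ_{n=1}^{n₀} |ν̂(n)|/n), where ν̂(n) = ∫_𝕋 exp(-inθ) dν(θ) and K > 0 is a universal constant. -/
open MeasureTheory Real

/-- The arc of the circle that is the image of the interval `(a, b]`. -/
def circleArc (T a b : ℝ) : Set (AddCircle T) := (fun x : ℝ => (x : AddCircle T)) '' Set.Ioc a b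

section Arc

variable {T : ℝ}

lemma circleArc_mono {a b a' b' : ℝ} (ha : a' ≤ a) (hb : b ≤ b') :
    circleArc T a b ⊆ circleArc T a' b' :=
  Set.image_mono (Set.Ioc_subset_Ioc ha hb)

lemma coe_sub_mem_circleArc {a b t : ℝ} {y : AddCircle T} :
    y - t ∈ circleArc T a b ↔ y ∈ circleArc T (a + t) (b + t) := by
  constructor
  · rintro ⟨x, hx, hxy⟩
    refine ⟨x + t, ⟨by linarith [hx.1], by linarith [hx.2]⟩, ?_⟩
    simp only [AddCircle.coe_add] at hxy ⊢
    rw [hxy, sub_add_cancel]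
  · rintro ⟨x, hx, rfl⟩
    exact ⟨x - t, ⟨by linarith [hx.1], by linarith [hx.2]⟩, by simp⟩

variable [hT : Fact (0 < T)]

lemma coe_mem_circleArc {a b x : ℝ} (hb : b ≤ a + T) (hx : x ∈ Set.Ioc a (a + T)) :
    (x : AddCircle T) ∈ circleArc T a b ↔ x ∈ Set.Ioc a b := by
  refine ⟨?_, fun h => ⟨x, h, rfl⟩⟩
  rintro ⟨y, hy, hyx⟩
  have hy' : y ∈ Set.Ioc a (a + T) := ⟨hy.1, hy.2.trans hb⟩
  rwa [← (AddCircle.coe_eq_coe_iff_of_mem_Ioc hy' hx).1 hyx]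

lemma exists_mem_Ioc_coe_eq (a : ℝ) (y : AddCircle T) :
    ∃ x ∈ Set.Ioc a (a + T), (x : AddCircle T) = y :=
  ⟨_, (AddCircle.equivIoc T a y).2, (AddCircle.equivIoc T a).symm_apply_apply y⟩

lemma circleArc_eq_univ {a b : ℝ} (hb : a + T ≤ b) : circleArc T a b = Set.univ := by
  refine Set.eq_univ_of_forall fun y => ?_
  obtain ⟨x, hx, rfl⟩ := exists_mem_Ioc_coe_eq a y
  exact ⟨x, ⟨hx.1, hx.2.trans hb⟩, rfl⟩

lemma measurableSet_circleArc (a b : ℝ) : MeasurableSet (circleArc T a b) := by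
  rcases le_total b (a + T) with hb | hb
  · refine measurableSet_Ioc.image_of_continuousOn_injOn
      (AddCircle.continuous_mk' T).continuousOn fun x hx y hy hxy => ?_
    exact (AddCircle.coe_eq_coe_iff_of_mem_Ioc (p := T) (a := a)
      ⟨hx.1, hx.2.trans hb⟩ ⟨hy.1, hy.2.trans hb⟩).1 hxy
  · rw [circleArc_eq_univ hb]
    exact MeasurableSet.univ

lemma compl_circleArc {a b : ℝ} (hab : a ≤ b) (hb : b ≤ a + T) :
    (circleArc T a b)ᶜ = circleArc T b (a + T) := by
  ext y
  obtain ⟨x, hx, rfl⟩ := exists_mem_Ioc_coe_eq a y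
  rw [Set.mem_compl_iff, coe_mem_circleArc hb hx]
  constructor
  · intro h
    exact ⟨x, ⟨by by_contra! h'; exact h ⟨hx.1, h'⟩, hx.2⟩, rfl⟩
  · rintro ⟨z, hz, hzx⟩ h
    have := (AddCircle.coe_eq_coe_iff_of_mem_Ioc (p := T) (a := a)
      ⟨hab.trans_lt hz.1, hz.2⟩ hx).1 hzx
    linarith [h.2, hz.1]

lemma setIntegral_circleArc {a b : ℝ} (hab : a ≤ b) (hb : b ≤ a + T) (f : AddCircle T → ℂ) :
    ∫ y in circleArc T a b, f y = ∫ x in a..b, f x := by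
  rw [← integral_indicator (measurableSet_circleArc a b), ← AddCircle.integral_preimage T a,
    intervalIntegral.integral_of_le hab,
    ← Set.inter_eq_self_of_subset_right (Set.Ioc_subset_Ioc_right hb : Set.Ioc a b ⊆ _),
    ← setIntegral_indicator measurableSet_Ioc]
  refine setIntegral_congr_fun measurableSet_Ioc fun x hx => ?_
  simp only [Set.indicator, coe_mem_circleArc hb hx]

lemma volume_real_circleArc {a b : ℝ} (hab : a ≤ b) (hb : b ≤ a + T) :
    volume.real (circleArc T a b) = b - a := by
  have h := setIntegral_circleArc hab hb (fun _ => 1)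
  simpa [← Complex.ofReal_sub] using h

end Arc

section Fourier

lemma norm_integral_fourier_eq_natAbs {T : ℝ} (ν : Measure (AddCircle T)) (m : ℤ) :
    ‖∫ x, fourier m x ∂ν‖ = ‖∫ x, fourier (-(m.natAbs : ℤ)) x ∂ν‖ := by
  have h (m : ℤ) : ‖∫ x, fourier (-m) x ∂ν‖ = ‖∫ x, fourier m x ∂ν‖ := by
    simp only [fourier_neg, integral_conj, RCLike.norm_conj]
  rcases Int.natAbs_eq m with hm | hm
  · rw [h, ← hm]
  · rw [← hm]

lemma integral_fourier_mul_measureReal {T : ℝ} [Fact (0 < T)] (ν : Measure (AddCircle T))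
    [IsFiniteMeasure ν] {A : Set (AddCircle T)} (hA : MeasurableSet A) (n : ℤ) :
    Integrable (fun t : AddCircle T => fourier n t * (ν.real {y | y - t ∈ A} : ℂ)) ∧
    ∫ t : AddCircle T, fourier n t * (ν.real {y | y - t ∈ A} : ℂ) =
      (∫ x, fourier n x ∂ν) * ∫ s in A, fourier (-n) s := by
  let F : AddCircle T × AddCircle T → ℂ :=
    fun p => fourier n p.1 * A.indicator (fun _ => (1 : ℂ)) (p.2 - p.1)
  have hF : Integrable F (volume.prod ν) := by
    refine Integrable.of_bound (C := 1) ?_ (Filter.Eventually.of_forall fun p => ?_)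
    · refine AEStronglyMeasurable.mul (by fun_prop) ?_
      exact ((stronglyMeasurable_const.indicator hA).comp_measurable
        (measurable_snd.sub measurable_fst)).aestronglyMeasurable
    · simp only [F, norm_mul]
      have h1 : ‖fourier n p.1‖ = 1 := by rw [fourier_apply, Circle.norm_coe]
      rw [h1, one_mul]
      exact (norm_indicator_le_norm_self _ _).trans (by simp)
  have hin (t : AddCircle T) : ∫ y, F (t, y) ∂ν = fourier n t * (ν.real {y | y - t ∈ A} : ℂ) := by
    have hm : MeasurableSet {y : AddCircle T | y - t ∈ A} := (measurable_id.sub_const t) hA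
    simp only [F]
    rw [integral_const_mul]
    congr 1
    have : (fun y : AddCircle T => A.indicator (fun _ => (1 : ℂ)) (y - t)) =
        {y : AddCircle T | y - t ∈ A}.indicator (fun _ => (1 : ℂ)) := by
      ext y; simp [Set.indicator]
    rw [this, integral_indicator hm]
    simp
  have hout (y : AddCircle T) :
      ∫ t, F (t, y) = fourier n y * ∫ s in A, fourier (-n) s := by
    rw [← integral_sub_left_eq_self _ _ y, ← integral_const_mul, ← integral_indicator hA]
    congr 1
    ext s
    simp only [F, sub_sub_cancel]
    by_cases hs : s ∈ A
    · simp [hs, fourier_apply, sub_eq_add_neg, AddCircle.toCircle_add, smul_add]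
    · simp [hs]
  constructor
  · simpa only [hin] using hF.integral_prod_left
  · have h := integral_integral_swap (f := fun t y => F (t, y)) hF
    simp only [hin, hout, integral_mul_const] at h
    exact h

lemma norm_setIntegral_fourier_circleArc_le [Fact (0 < 2 * π)] {a b : ℝ} (hab : a ≤ b)
    (hb : b ≤ a + 2 * π) {n : ℤ} (hn : n ≠ 0) :
    ‖∫ s in circleArc (2 * π) a b, fourier n s‖ ≤ 2 / n.natAbs := by
  rw [setIntegral_circleArc hab hb]
  have hc : Complex.I * n ≠ 0 := by simp [hn]
  have h (x : ℝ) : fourier n (x : AddCircle (2 * π)) = Complex.exp (Complex.I * n * x) := by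
    rw [fourier_coe_apply]
    congr 1
    have : (π : ℂ) ≠ 0 := by exact_mod_cast pi_ne_zero
    push_cast
    field_simp
  simp only [h]
  rw [integral_exp_mul_complex hc, norm_div]
  have e (x : ℝ) : ‖Complex.exp (Complex.I * n * x)‖ = 1 := by
    rw [← h, fourier_apply, Circle.norm_coe]
  have hd : ‖Complex.I * n‖ = n.natAbs := by
    simp [Nat.cast_natAbs]
  rw [hd]
  gcongr
  refine (norm_sub_le _ _).trans ?_
  rw [e, e]; norm_num

lemma integral_fourier {T : ℝ} [hT : Fact (0 < T)] (n : ℤ) :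
    ∫ t : AddCircle T, fourier n t = if n = 0 then (T : ℂ) else 0 := by
  split_ifs with h
  · subst h
    simp [measureReal_def, AddCircle.measure_univ, hT.out.le]
  · exact integral_eq_zero_of_add_right_eq_neg (g := ((T / 2 / n : ℝ) : AddCircle T))
      (fun x => fourier_add_half_inv_index h hT.out x)

end Fourier

section Fejer

/-- The Fejér kernel of order `N`, as a function on the circle. -/
noncomputable def fejerKernel {T : ℝ} (N : ℕ) (t : AddCircle T) : ℝ :=
  ‖∑ k ∈ Finset.range N, fourier (k : ℤ) t‖ ^ 2 / N

lemma continuous_fejerKernel {T : ℝ} (N : ℕ) : Continuous (fejerKernel (T := T) N) := by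
  unfold fejerKernel
  fun_prop

lemma fejerKernel_nonneg {T : ℝ} (N : ℕ) (t : AddCircle T) : 0 ≤ fejerKernel N t := by
  unfold fejerKernel
  positivity

lemma ofReal_fejerKernel {T : ℝ} (N : ℕ) (t : AddCircle T) :
    (fejerKernel N t : ℂ) =
      (∑ j ∈ Finset.range N, ∑ k ∈ Finset.range N, fourier ((j : ℤ) - k) t) / N := by
  unfold fejerKernel
  push_cast
  rw [← Complex.mul_conj', map_sum, Finset.sum_mul_sum]
  simp only [← fourier_neg, ← fourier_add, sub_eq_add_neg]

lemma integral_fejerKernel {T : ℝ} [Fact (0 < T)] {N : ℕ} (hN : N ≠ 0) :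
    ∫ t : AddCircle T, fejerKernel N t = T := by
  have hi (n : ℤ) : Integrable (fun t : AddCircle T => fourier n t) :=
    (map_continuous (fourier n)).integrable_of_hasCompactSupport (HasCompactSupport.of_compactSpace _)
  have h : ((∫ t : AddCircle T, fejerKernel N t : ℝ) : ℂ) = T := by
    rw [← integral_complex_ofReal]
    simp only [ofReal_fejerKernel]
    rw [integral_div, integral_finsetSum _ fun j _ => integrable_finsetSum _ fun k _ => hi _]
    simp only [integral_finsetSum _ fun k _ => hi _, integral_fourier, sub_eq_zero, Nat.cast_inj]
    rw [Finset.sum_congr rfl fun j hj => by rw [Finset.sum_ite_eq, if_pos hj]]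
    simp [hN]
  exact_mod_cast h

lemma sq_mul_fejerKernel_le {N : ℕ} {x : ℝ} (hx : |x| ≤ π) :
    x ^ 2 * fejerKernel N (x : AddCircle (2 * π)) ≤ π ^ 2 / N := by
  unfold fejerKernel
  set D := ∑ k ∈ Finset.range N, fourier (k : ℤ) (x : AddCircle (2 * π)) with hD
  have hpow (k : ℕ) : fourier (k : ℤ) (x : AddCircle (2 * π)) = Complex.exp (Complex.I * x) ^ k := by
    rw [fourier_coe_apply, ← Complex.exp_nat_mul]
    congr 1
    have : (π : ℂ) ≠ 0 := by exact_mod_cast pi_ne_zero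
    push_cast
    field_simp
  have h1 : D * (Complex.exp (Complex.I * x) - 1) = Complex.exp (Complex.I * x) ^ N - 1 := by
    rw [hD, Finset.sum_congr rfl fun k _ => hpow k, geom_sum_mul]
  have h2 : ‖D‖ * ‖Complex.exp (Complex.I * x) - 1‖ ≤ 2 := by
    rw [← norm_mul, h1]
    refine (norm_sub_le _ _).trans ?_
    rw [norm_pow, mul_comm, Complex.norm_exp_ofReal_mul_I]
    norm_num
  have h3 : 2 / π * |x| ≤ ‖Complex.exp (Complex.I * x) - 1‖ := by
    rw [Complex.norm_exp_I_mul_ofReal_sub_one, norm_mul, Real.norm_eq_abs, Real.norm_eq_abs]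
    have := mul_abs_le_abs_sin (x := x / 2) (by rw [abs_div, abs_two]; linarith)
    rw [abs_div, abs_two] at this
    rw [abs_two]
    linarith
  have h4 : |x| * ‖D‖ ≤ π := by
    have h5 : ‖D‖ * (2 / π * |x|) ≤ 2 := (by gcongr : _ ≤ _).trans h2
    have h6 : ‖D‖ * (2 / π * |x|) = 2 * (|x| * ‖D‖) / π := by ring
    rw [h6, div_le_iff₀ pi_pos] at h5
    linarith
  rw [← mul_div_assoc]
  gcongr
  rw [← sq_abs x, ← mul_pow]
  gcongr

lemma integral_inv_one_add_div_sq_le {h : ℝ} (hh : 0 < h) :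
    ∫ x in (-π)..π, (1 + (x / h) ^ 2)⁻¹ ≤ h * π := by
  rw [intervalIntegral.integral_comp_div (fun x => (1 + x ^ 2)⁻¹) hh.ne', integral_inv_one_add_sq,
    smul_eq_mul]
  gcongr
  linarith [arctan_lt_pi_div_two (π / h), neg_pi_div_two_lt_arctan (-π / h)]

lemma fejerKernel_le_of_le_abs {N : ℕ} {h x : ℝ} (hh : 0 < h) (hx : h ≤ |x|) (hx' : |x| ≤ π) :
    fejerKernel N (x : AddCircle (2 * π)) ≤ 2 * π ^ 2 / (N * h ^ 2) * (1 + (x / h) ^ 2)⁻¹ := by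
  have hJ := fejerKernel_nonneg N (x : AddCircle (2 * π))
  have hx2 : h ^ 2 ≤ x ^ 2 := sq_le_sq.2 (by rwa [abs_of_pos hh])
  have e : 2 * π ^ 2 / (N * h ^ 2) * (1 + (x / h) ^ 2)⁻¹ = 2 * (π ^ 2 / N) / (h ^ 2 + x ^ 2) := by
    rw [← div_eq_mul_inv, ← div_div, div_div _ (h ^ 2), mul_add, mul_one, div_pow,
      mul_div_cancel₀ _ (by positivity), mul_div_assoc]
  rw [e, le_div_iff₀ (by positivity)]
  nlinarith [sq_mul_fejerKernel_le (N := N) hx']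

lemma measurable_measureReal_sub_mem {T : ℝ} (ν : Measure (AddCircle T)) [IsFiniteMeasure ν]
    {A : Set (AddCircle T)} (hA : MeasurableSet A) :
    Measurable fun t : AddCircle T => ν.real {y | y - t ∈ A} :=
  (measurable_measure_prodMk_left
    (s := {p : AddCircle T × AddCircle T | p.2 - p.1 ∈ A})
    ((measurable_snd.sub measurable_fst) hA)).ennreal_toReal

lemma sum_range_natAbs_sub_le {u : ℕ → ℝ} (h0 : u 0 = 0) (hu : ∀ n, 0 ≤ u n) {N j : ℕ}
    (hj : j < N) :
    ∑ k ∈ Finset.range N, u ((j : ℤ) - k).natAbs ≤ 2 * ∑ n ∈ Finset.Icc 1 N, u n := by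
  have h : ∑ k ∈ Finset.range N, u ((j : ℤ) - k).natAbs =
      ∑ k ∈ (Finset.range N).erase j, u ((j : ℤ) - k).natAbs := by
    rw [Finset.sum_erase]
    simp [h0]
  rw [h, ← Finset.sum_fiberwise_of_maps_to (t := Finset.Icc 1 N)
    (g := fun k : ℕ => ((j : ℤ) - k).natAbs), Finset.mul_sum]
  · refine Finset.sum_le_sum fun n _ => ?_
    rw [Finset.sum_congr rfl (g := fun _ => u n)
      fun k hk => by rw [(Finset.mem_filter.1 hk).2], Finset.sum_const, nsmul_eq_mul]
    refine mul_le_mul_of_nonneg_right ?_ (hu n)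
    have hc : ((Finset.range N).erase j |>.filter fun k : ℕ => ((j : ℤ) - k).natAbs = n).card ≤ 2 := by
      refine (Finset.card_le_card (t := {j + n, j - n}) fun k hk => ?_).trans Finset.card_le_two
      simp only [Finset.mem_filter, Finset.mem_insert, Finset.mem_singleton] at hk ⊢
      omega
    exact_mod_cast hc
  · intro k hk
    simp only [Finset.mem_erase, Finset.mem_range, Finset.mem_Icc] at hk ⊢
    omega

lemma abs_integral_fejerKernel_mul_le [Fact (0 < 2 * π)] (ν : Measure (AddCircle (2 * π)))
    [IsProbabilityMeasure ν] {N : ℕ} (hN : N ≠ 0) {a b : ℝ} (hab : a ≤ b)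
    (hb : b ≤ a + 2 * π) :
    |∫ t : AddCircle (2 * π), fejerKernel N t *
        (ν.real {y | y - t ∈ circleArc (2 * π) a b} - (b - a) / (2 * π))| ≤
      4 * ∑ n ∈ Finset.Icc 1 N, ‖∫ x, fourier (-(n : ℤ)) x ∂ν‖ / n := by
  set A := circleArc (2 * π) a b with hA
  have hAm : MeasurableSet A := measurableSet_circleArc a b
  set g : ℕ → ℝ := fun n => ‖∫ x, fourier (-(n : ℤ)) x ∂ν‖ / n with hg
  let G : ℤ → AddCircle (2 * π) → ℂ := fun m t =>
    fourier m t * (ν.real {y | y - t ∈ A} : ℂ) - fourier m t * (((b - a) / (2 * π) : ℝ) : ℂ)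
  have hi (n : ℤ) : Integrable (fun t : AddCircle (2 * π) => fourier n t) :=
    (map_continuous (fourier n)).integrable_of_hasCompactSupport (HasCompactSupport.of_compactSpace _)
  have hG (m : ℤ) : Integrable (G m) :=
    (integral_fourier_mul_measureReal ν hAm m).1.sub ((hi m).mul_const _)
  have hGn (m : ℤ) : ‖∫ t, G m t‖ ≤ 2 * g m.natAbs := by
    simp only [G]
    rw [integral_sub (integral_fourier_mul_measureReal ν hAm m).1 ((hi m).mul_const _),
      (integral_fourier_mul_measureReal ν hAm m).2, integral_mul_const, integral_fourier]
    rcases eq_or_ne m 0 with rfl | hm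
    · have hv : volume.real A = b - a := volume_real_circleArc hab hb
      have : (π : ℂ) ≠ 0 := by exact_mod_cast pi_ne_zero
      have e : ((2 * π : ℝ) : ℂ) * (((b - a) / (2 * π) : ℝ) : ℂ) = ((b - a : ℝ) : ℂ) := by
        push_cast
        field_simp
      simp [hg, hv, e, -Complex.ofReal_mul, -Complex.ofReal_div]
    · rw [if_neg hm, zero_mul, sub_zero, norm_mul, norm_integral_fourier_eq_natAbs]
      have := norm_setIntegral_fourier_circleArc_le hab hb (neg_ne_zero.2 hm)
      rw [Int.natAbs_neg] at this
      calc _ ≤ ‖∫ x, fourier (-(m.natAbs : ℤ)) x ∂ν‖ * (2 / m.natAbs) := by gcongr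
        _ = _ := by simp only [hg]; ring
  have hJ : ((∫ t : AddCircle (2 * π), fejerKernel N t *
        (ν.real {y | y - t ∈ A} - (b - a) / (2 * π)) : ℝ) : ℂ) =
      (∑ j ∈ Finset.range N, ∑ k ∈ Finset.range N, ∫ t, G ((j : ℤ) - k) t) / N := by
    rw [← integral_complex_ofReal]
    simp only [← integral_finsetSum _ fun k _ => hG _]
    rw [← integral_finsetSum _ fun j _ => integrable_finsetSum _ fun k _ => hG _, ← integral_div]
    congr 1
    ext t
    rw [Complex.ofReal_mul, ofReal_fejerKernel]
    simp only [G, ← mul_sub, ← Finset.sum_mul]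
    push_cast
    ring
  rw [← Real.norm_eq_abs, ← Complex.norm_real, hJ, norm_div, Complex.norm_natCast]
  have hN' : (0 : ℝ) < N := by positivity
  rw [div_le_iff₀ hN']
  refine (norm_sum_le _ _).trans ?_
  have hj (j : ℕ) (hj : j ∈ Finset.range N) :
      ‖∑ k ∈ Finset.range N, ∫ t, G ((j : ℤ) - k) t‖ ≤ 4 * ∑ n ∈ Finset.Icc 1 N, g n := by
    refine (norm_sum_le_of_le _ fun k _ => hGn _).trans ?_
    rw [← Finset.mul_sum]
    have := sum_range_natAbs_sub_le (u := g) (by simp [hg]) (fun n => by positivity)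
      (Finset.mem_range.1 hj)
    linarith
  refine (Finset.sum_le_card_nsmul _ _ _ hj).trans_eq ?_
  rw [Finset.card_range, nsmul_eq_mul, mul_comm]

end Fejer

section Discrepancy

variable (ν : Measure (AddCircle (2 * π)))

/-- The signed discrepancy of `ν` on the arc `(a, b]`. -/
noncomputable def arcDiscrepancy (a b : ℝ) : ℝ :=
  ν.real (circleArc (2 * π) a b) - (b - a) / (2 * π)

lemma arcDiscrepancy_add (a b t : ℝ) :
    ν.real {y | y - t ∈ circleArc (2 * π) a b} - (b - a) / (2 * π) =
      arcDiscrepancy ν (a + t) (b + t) := by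
  simp only [coe_sub_mem_circleArc, arcDiscrepancy, Set.ofPred_mem_eq, add_sub_add_right_eq_sub]

variable [hT : Fact (0 < 2 * π)] [IsProbabilityMeasure ν]

lemma arcDiscrepancy_add_two_pi {a b : ℝ} (hab : a ≤ b) (hb : b ≤ a + 2 * π) :
    arcDiscrepancy ν b (a + 2 * π) = -arcDiscrepancy ν a b := by
  unfold arcDiscrepancy
  rw [← compl_circleArc hab hb, probReal_compl_eq_one_sub (measurableSet_circleArc a b)]
  field_simp
  ring

lemma abs_arcDiscrepancy_le_one {a b : ℝ} (hab : a ≤ b) (hb : b ≤ a + 2 * π) :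
    |arcDiscrepancy ν a b| ≤ 1 := by
  have h1 : ν.real (circleArc (2 * π) a b) ≤ 1 := measureReal_le_one
  have h0 : 0 ≤ ν.real (circleArc (2 * π) a b) := measureReal_nonneg
  have h2 : (b - a) / (2 * π) ≤ 1 := by
    rw [div_le_one hT.out]; linarith
  have h3 : 0 ≤ (b - a) / (2 * π) := div_nonneg (by linarith) hT.out.le
  unfold arcDiscrepancy
  rw [abs_le]
  constructor <;> linarith

lemma arcDiscrepancy_le_of_forall_abs_le {N : ℕ} (hN : N ≠ 0) {Δ : ℝ}
    (hΔ : ∀ a b : ℝ, a ≤ b → b ≤ a + 2 * π → |arcDiscrepancy ν a b| ≤ Δ) {a b : ℝ}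
    (hab : a ≤ b) (hb : b ≤ a + 2 * π) :
    arcDiscrepancy ν a b ≤ Δ / 3 + 4 * π / N +
      8 / (3 * π) * ∑ n ∈ Finset.Icc 1 N, ‖∫ x, fourier (-(n : ℤ)) x ∂ν‖ / n := by
  set S := ∑ n ∈ Finset.Icc 1 N, ‖∫ x, fourier (-(n : ℤ)) x ∂ν‖ / n with hS
  have hS0 : 0 ≤ S := by positivity
  have hΔ0 : 0 ≤ Δ := (abs_nonneg _).trans (hΔ a b hab hb)
  have hN' : (0 : ℝ) < N := by positivity
  have hπ := pi_pos
  set h := 4 * π ^ 2 / N with hh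
  have hpos : 0 < h := by positivity
  have hhπ : 4 * π / N = h / π := by rw [hh]; field_simp
  rw [hhπ]
  have hS1 : 0 ≤ 8 / (3 * π) * S := by positivity
  rcases lt_or_ge (a - h + 2 * π) (b + h) with hlong | hshort
  · have h1 : ν.real (circleArc (2 * π) a b) ≤ 1 := measureReal_le_one
    have h2 : 1 - h / π ≤ (b - a) / (2 * π) := by
      rw [le_div_iff₀ hT.out]
      have : (1 - h / π) * (2 * π) = 2 * π - 2 * h := by field_simp
      linarith
    unfold arcDiscrepancy
    linarith
  set c := arcDiscrepancy ν a b - h / π with hc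
  rcases le_total c 0 with hc0 | hc0
  · linarith
  set J : ℝ → ℝ := fun x => fejerKernel N (x : AddCircle (2 * π)) with hJ
  set φ : ℝ → ℝ := fun x => arcDiscrepancy ν (a - h + x) (b + h + x) with hφ
  set q : ℝ → ℝ := fun x => 2 * π ^ 2 / (N * h ^ 2) * (1 + (x / h) ^ 2)⁻¹ with hq
  have hJ0 (x : ℝ) : 0 ≤ J x := fejerKernel_nonneg _ _
  have hq0 (x : ℝ) : 0 ≤ q x := by positivity
  have hJc : Continuous J := (continuous_fejerKernel N).comp (AddCircle.continuous_mk' _)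
  have hqc : Continuous q :=
    continuous_const.mul (Continuous.inv₀ (by fun_prop) fun x => by positivity)
  have hφΔ (x : ℝ) : |φ x| ≤ Δ := hΔ _ _ (by linarith) (by linarith)
  have hφc (x : ℝ) (hx : |x| ≤ h) : c ≤ φ x := by
    rw [abs_le] at hx
    have h1 : ν.real (circleArc (2 * π) a b) ≤
        ν.real (circleArc (2 * π) (a - h + x) (b + h + x)) :=
      measureReal_mono (circleArc_mono (by linarith) (by linarith))
    have h2 : (b + h + x - (a - h + x)) / (2 * π) = (b - a) / (2 * π) + h / π := by
      field_simp
      ring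
    simp only [hc, hφ, arcDiscrepancy, h2]
    linarith
  have hpt (x : ℝ) (hx : |x| ≤ π) : c * J x - (c + Δ) * q x ≤ J x * φ x := by
    rcases le_total |x| h with hxh | hxh
    · nlinarith [mul_le_mul_of_nonneg_left (hφc x hxh) (hJ0 x),
        mul_nonneg (add_nonneg hc0 hΔ0) (hq0 x)]
    · nlinarith [mul_le_mul_of_nonneg_left (abs_le.1 (hφΔ x)).1 (hJ0 x),
        mul_le_mul_of_nonneg_left (fejerKernel_le_of_le_abs (N := N) hpos hxh hx)
          (add_nonneg hc0 hΔ0)]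
  have hφm : Measurable φ := by
    have := ((measurable_measureReal_sub_mem ν
      (measurableSet_circleArc (T := 2 * π) (a - h) (b + h))).comp
      AddCircle.measurable_mk').sub_const ((b + h - (a - h)) / (2 * π))
    exact (funext fun x => arcDiscrepancy_add ν (a - h) (b + h) x :
      _ = φ) ▸ this
  have hJφ : IntervalIntegrable (fun x => J x * φ x) volume (-π) π := by
    rw [intervalIntegrable_iff]
    exact (intervalIntegrable_iff.1 (hJc.intervalIntegrable _ _)).mul_bdd (c := Δ)
      hφm.aestronglyMeasurable (Filter.Eventually.of_forall hφΔ)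
  have hcJ := (hJc.intervalIntegrable (μ := volume) (-π) π).const_mul c
  have hcq := (hqc.intervalIntegrable (μ := volume) (-π) π).const_mul (c + Δ)
  have hle : ∫ x in (-π)..π, (c * J x - (c + Δ) * q x) ≤ ∫ x in (-π)..π, J x * φ x :=
    intervalIntegral.integral_mono_on (by linarith) (hcJ.sub hcq) hJφ
      fun x hx => hpt x (abs_le.2 hx)
  have hcirc (f : AddCircle (2 * π) → ℝ) : ∫ x in (-π)..π, f x = ∫ t, f t := by
    rw [← AddCircle.intervalIntegral_preimage (2 * π) (-π) f]
    congr 1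
    ring
  have hJint : ∫ x in (-π)..π, J x = 2 * π := by
    rw [hcirc, integral_fejerKernel hN]
  have hqint : ∫ x in (-π)..π, q x ≤ π / 2 := by
    rw [intervalIntegral.integral_const_mul]
    refine (mul_le_mul_of_nonneg_left (integral_inv_one_add_div_sq_le hpos)
      (by positivity)).trans_eq ?_
    rw [hh]
    field_simp
    norm_num
  have hup : ∫ x in (-π)..π, J x * φ x ≤ 4 * S := by
    have := abs_integral_fejerKernel_mul_le ν hN (a := a - h) (b := b + h) (by linarith)
      (by linarith)
    rw [← hcirc] at this
    simp only [arcDiscrepancy_add] at this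
    exact (le_abs_self _).trans this
  rw [intervalIntegral.integral_sub hcJ hcq, intervalIntegral.integral_const_mul,
    intervalIntegral.integral_const_mul, hJint] at hle
  have h1 : (c + Δ) * ∫ x in (-π)..π, q x ≤ (c + Δ) * (π / 2) := by gcongr
  have h2 : c ≤ Δ / 3 + 8 / (3 * π) * S := by
    have h3 : c * (3 * π) ≤ Δ * π + 8 * S := by linarith
    rw [← le_div_iff₀ (by positivity)] at h3
    refine h3.trans_eq ?_
    field_simp
  linarith

lemma abs_arcDiscrepancy_le {N : ℕ} (hN : N ≠ 0) {a b : ℝ} (hab : a ≤ b)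
    (hb : b ≤ a + 2 * π) :
    |arcDiscrepancy ν a b| ≤
      6 * π * (1 / N + ∑ n ∈ Finset.Icc 1 N, ‖∫ x, fourier (-(n : ℤ)) x ∂ν‖ / n) := by
  set S := ∑ n ∈ Finset.Icc 1 N, ‖∫ x, fourier (-(n : ℤ)) x ∂ν‖ / n with hS
  have hS0 : 0 ≤ S := by positivity
  let ι := {p : ℝ × ℝ // p.1 ≤ p.2 ∧ p.2 ≤ p.1 + 2 * π}
  have : Nonempty ι := ⟨⟨(a, b), hab, hb⟩⟩
  set Δ := ⨆ p : ι, |arcDiscrepancy ν p.1.1 p.1.2| with hΔ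
  have hbdd : BddAbove (Set.range fun p : ι => |arcDiscrepancy ν p.1.1 p.1.2|) :=
    ⟨1, by rintro _ ⟨p, rfl⟩; exact abs_arcDiscrepancy_le_one ν p.2.1 p.2.2⟩
  have hle (a b : ℝ) (hab : a ≤ b) (hb : b ≤ a + 2 * π) : |arcDiscrepancy ν a b| ≤ Δ :=
    le_ciSup hbdd (⟨(a, b), hab, hb⟩ : ι)
  have hstep : Δ ≤ Δ / 3 + 4 * π / N + 8 / (3 * π) * S := by
    refine ciSup_le fun p => abs_le'.2 ⟨?_, ?_⟩
    · exact arcDiscrepancy_le_of_forall_abs_le ν hN hle p.2.1 p.2.2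
    · rw [← arcDiscrepancy_add_two_pi ν p.2.1 p.2.2]
      exact arcDiscrepancy_le_of_forall_abs_le ν hN hle p.2.2 (by linarith [p.2.1])
  have hK : 8 / (3 * π) * S ≤ 4 * π * S := by
    gcongr
    rw [div_le_iff₀ (by positivity)]
    nlinarith [pi_gt_three]
  have hd : 4 * π / N = 4 * π * (1 / N) := by ring
  have := hle a b hab hb
  linarith

end Discrepancy

/-- **Erdős–Turán inequality.** For any probability measure `ν` on the circle
`𝕋 = ℝ/2πℤ`, any `n₀ ≥ 1` and any arc `A` (the image in `𝕋` of an interval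
`Ioc a b` of `ℝ`), the discrepancy `|ν(A) - mes A/(2π)|` is bounded by
`K (1/n₀ + ∑_{n=1}^{n₀} |ν̂(n)|/n)`, where `ν̂(n) = ∫ exp(-inθ) dν(θ)`. -/
theorem erdos_turan :
    ∃ K : ℝ, 0 < K ∧
      ∀ (ν : Measure (AddCircle (2 * π))), IsProbabilityMeasure ν →
        ∀ n₀ : ℕ, 1 ≤ n₀ → ∀ a b : ℝ,
          haveI : Fact (0 < 2 * π) := ⟨by positivity⟩
          |(ν ((fun x : ℝ => (x : AddCircle (2 * π))) '' Set.Ioc a b)).toReal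
              - (volume ((fun x : ℝ => (x : AddCircle (2 * π))) '' Set.Ioc a b)).toReal / (2 * π)|
            ≤ K * (1 / n₀ + ∑ n ∈ Finset.Icc 1 n₀,
                ‖∫ θ, fourier (-(n : ℤ)) θ ∂ν‖ / n) := by
  refine ⟨6 * π, by positivity, fun ν hν N hN a b => ?_⟩
  have hT : Fact (0 < 2 * π) := ⟨by positivity⟩
  change |ν.real (circleArc (2 * π) a b) - volume.real (circleArc (2 * π) a b) / (2 * π)| ≤ _
  have hR : 0 ≤ 6 * π * (1 / (N : ℝ) +
      ∑ n ∈ Finset.Icc 1 N, ‖∫ θ, fourier (-(n : ℤ)) θ ∂ν‖ / n) := by positivity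
  rcases lt_or_ge b a with hba | hab
  · simpa [circleArc, Set.Ioc_eq_empty_of_le hba.le] using hR
  rcases le_total b (a + 2 * π) with hb | hb
  · rw [volume_real_circleArc hab hb]
    exact abs_arcDiscrepancy_le ν (by omega) hab hb
  · rw [circleArc_eq_univ hb]
    simpa [measureReal_def, AddCircle.measure_univ, hT.out.le, pi_pos.le, pi_ne_zero] using hR
end

section
/- There is a universal constant K > 0 such that for any probability measure μ on ℝ, any positive integer n₀, and any x₀ ∈ ℝ, one has |μ[x₀,∞) - σ₁[x₀,∞)| ≤ K·(1/n₀ + Σ_{n=1}^{n₀} (1/n)·|∫_ℝ T_n(x) dμ(x)|), where T_n are the Chebyshev polynomials of the first kind. -/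
open MeasureTheory Real Polynomial

/-- The arcsine probability measure `dσ₁(x) = (1/π)(1-x²)₊^{-1/2} dx` on `[-1,1]`. -/
noncomputable def arcsineMeasure : Measure ℝ :=
  volume.withDensity (fun x =>
    ENNReal.ofReal (Set.indicator (Set.Ioo (-1 : ℝ) 1)
      (fun x => (π * Real.sqrt (1 - x ^ 2))⁻¹) x))

namespace ErdosTuran

/-- A Bézout identity for two families of roots separated by order: both cofactors have a
definite sign on the far side of the opposite family. -/
theorem exists_bezout_of_forall_lt (Y T : Multiset ℝ) (h : ∀ y ∈ Y, ∀ t ∈ T, y < t) :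
    ∃ Q R : ℝ[X],
      (Y.map (X - C ·)).prod * Q + (T.map (X - C ·)).prod * R = 1 ∧
      ((Y.map (X - C ·)).prod * Q).natDegree ≤ Y.card + T.card - 1 ∧
      (∀ x, (∀ t ∈ T, x ≤ t) → 0 ≤ Q.eval x) ∧
      ∀ x, (∀ y ∈ Y, y ≤ x) → 0 ≤ (-1) ^ T.card * R.eval x := by
  induction Y using Multiset.induction_on generalizing T with
  | empty => exact ⟨1, 0, by simp⟩
  | cons y Y ihY =>
    induction T using Multiset.induction_on with
    | empty => exact ⟨0, 1, by simp⟩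
    | cons t T ihT =>
      obtain ⟨Q₁, R₁, e₁, d₁, q₁, r₁⟩ := ihY (t ::ₘ T)
        fun a ha => h a (Multiset.mem_cons_of_mem ha)
      obtain ⟨Q₂, R₂, e₂, d₂, q₂, r₂⟩ := ihT
        fun a ha b hb => h a ha b (Multiset.mem_cons_of_mem hb)
      have hyt : 0 < t - y :=
        sub_pos.2 (h y (Multiset.mem_cons_self _ _) t (Multiset.mem_cons_self _ _))
      simp only [Multiset.map_cons, Multiset.prod_cons, Multiset.card_cons] at *
      set L := (Y.map (X - C ·)).prod
      set M := (T.map (X - C ·)).prod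
      have hC : C (t - y)⁻¹ * (C t - C y) = (1 : ℝ[X]) := by
        rw [← C_sub, ← C_mul, inv_mul_cancel₀ hyt.ne', C_1]
      refine ⟨C (t - y)⁻¹ * (Q₁ - (X - C t) * Q₂), C (t - y)⁻¹ * ((X - C y) * R₁ - R₂),
        ?_, ?_, fun x hx => ?_, fun x hx => ?_⟩
      · linear_combination hC + C (t - y)⁻¹ * ((X - C y) * e₁ - (X - C t) * e₂)
      · have e : (X - C y) * L * (C (t - y)⁻¹ * (Q₁ - (X - C t) * Q₂)) =
            C (t - y)⁻¹ * ((X - C y) * (L * Q₁) - (X - C t) * ((X - C y) * L * Q₂)) := by ring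
        rw [e]
        refine (natDegree_C_mul_le _ _).trans ((natDegree_sub_le _ _).trans (max_le ?_ ?_)) <;>
        · refine natDegree_mul_le.trans ?_
          rw [natDegree_X_sub_C]
          omega
      · have h₁ := q₁ x hx
        have h₂ := q₂ x fun b hb => hx b (Multiset.mem_cons_of_mem hb)
        have h₃ := hx t (Multiset.mem_cons_self _ _)
        simp only [eval_mul, eval_sub, eval_C, eval_X]
        have := mul_nonneg (sub_nonneg.2 h₃) h₂
        exact mul_nonneg (inv_nonneg.2 hyt.le) (by linarith)
      · have h₁ := r₁ x fun b hb => hx b (Multiset.mem_cons_of_mem hb)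
        have h₂ := r₂ x hx
        have h₃ := hx y (Multiset.mem_cons_self _ _)
        simp only [eval_mul, eval_sub, eval_C, eval_X]
        have := mul_nonneg (sub_nonneg.2 h₃) h₁
        have e : (-1) ^ (T.card + 1) * ((t - y)⁻¹ * ((x - y) * R₁.eval x - R₂.eval x)) =
          (t - y)⁻¹ * ((x - y) * ((-1) ^ (T.card + 1) * R₁.eval x) +
            (-1) ^ T.card * R₂.eval x) := by ring
        rw [e]
        exact mul_nonneg (inv_nonneg.2 hyt.le) (by linarith)

/-- The `i`-th zero, from the right, of the Chebyshev polynomial `Tₙ`. -/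
noncomputable def node (n i : ℕ) : ℝ := cos ((2 * i + 1) / (2 * n) * π)

theorem node_lt_node {n i j : ℕ} (hij : i < j) (hj : j < n) : node n j < node n i := by
  have hn : (0 : ℝ) < 2 * n := by
    have : 0 < n := by omega
    positivity
  have h₁ : (i : ℝ) < j := by exact_mod_cast hij
  have h₂ : (j : ℝ) + 1 ≤ n := by exact_mod_cast hj
  refine cos_lt_cos_of_nonneg_of_le_pi (by positivity) ?_ ?_
  · exact mul_le_of_le_one_left pi_pos.le ((div_le_one hn).2 (by linarith))
  · gcongr

/-- The Markov–Stieltjes majorant of the indicator of `[node n j, ∞)`. -/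
theorem exists_majorant {n j : ℕ} (hj : j < n) :
    ∃ P : ℝ[X], P.natDegree ≤ 2 * n - 2 ∧ (∀ x, 0 ≤ P.eval x) ∧
      (∀ x, node n j ≤ x → 1 ≤ P.eval x) ∧
      Chebyshev.sumZeroes n P = π * (j + 1) / n := by
  set A : Multiset ℝ := (Finset.Ico (j + 1) n).val.map (node n) with hA
  set B : Multiset ℝ := (Finset.range j).val.map (node n) with hB
  have hAlt : ∀ y ∈ A, y < node n j := by
    intro y hy
    obtain ⟨i, hi, rfl⟩ := Multiset.mem_map.1 hy
    rw [Finset.mem_val, Finset.mem_Ico] at hi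
    exact node_lt_node (by omega) (by omega)
  have hBlt : ∀ t ∈ B, node n j < t := by
    intro y hy
    obtain ⟨i, hi, rfl⟩ := Multiset.mem_map.1 hy
    rw [Finset.mem_val, Finset.mem_range] at hi
    exact node_lt_node (by omega) (by omega)
  obtain ⟨Q, R, e, d, q, r⟩ := exists_bezout_of_forall_lt (A + A) (node n j ::ₘ (B + B)) (by
    intro y hy t ht
    have hy' : y < node n j := by
      rcases Multiset.mem_add.1 hy with hy | hy <;> exact hAlt y hy
    rcases Multiset.mem_cons.1 ht with rfl | ht
    · exact hy'
    · rcases Multiset.mem_add.1 ht with ht | ht <;> exact hy'.trans (hBlt t ht))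
  have hcA : A.card = n - (j + 1) := by simp [hA]
  have hcB : B.card = j := by simp [hB]
  have hodd : (-1 : ℝ) ^ (j + j + 1) = -1 := Odd.neg_one_pow ⟨j, by ring⟩
  simp only [Multiset.map_add, Multiset.map_cons, Multiset.prod_cons, Multiset.prod_add,
    Multiset.card_add, Multiset.card_cons, hcA, hcB, hodd] at e d q r
  set L := (A.map (X - C ·)).prod with hL
  set M := (B.map (X - C ·)).prod with hM
  have heval : ∀ x, (L * L * Q).eval x = 1 - (x - node n j) * M.eval x ^ 2 * R.eval x := by
    intro x
    have := congrArg (eval x) e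
    simp only [eval_add, eval_mul, eval_sub, eval_C, eval_X, eval_one] at this ⊢
    linear_combination this
  have hright : ∀ x, node n j ≤ x → 1 ≤ (L * L * Q).eval x := by
    intro x hx
    have hR := r x fun y hy => by
      rcases Multiset.mem_add.1 hy with hy | hy <;> exact (hAlt y hy).le.trans hx
    have := mul_nonneg (mul_nonneg (sub_nonneg.2 hx) (sq_nonneg (M.eval x))) hR
    rw [heval]
    linarith
  refine ⟨L * L * Q, by omega, fun x => ?_, hright, ?_⟩
  · rcases le_total (node n j) x with hx | hx
    · exact zero_le_one.trans (hright x hx)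
    · have hQ := q x fun t ht => by
        rcases Multiset.mem_cons.1 ht with rfl | ht
        · exact hx
        · rcases Multiset.mem_add.1 ht with ht | ht <;> exact hx.trans (hBlt t ht).le
      rw [eval_mul, eval_mul]
      exact mul_nonneg (mul_self_nonneg _) hQ
  · have hval : ∀ i ∈ Finset.range n,
        (L * L * Q).eval (node n i) = if i < j + 1 then 1 else 0 := by
      intro i hi
      rw [Finset.mem_range] at hi
      split_ifs with hij
      · rw [heval]
        rcases Nat.lt_succ_iff_lt_or_eq.1 hij with hij | rfl
        · have : M.eval (node n i) = 0 := by
            rw [hM, eval_multiset_prod, Multiset.prod_eq_zero_iff]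
            simp only [Multiset.mem_map, hB]
            exact ⟨_, ⟨_, ⟨i, by simpa using hij, rfl⟩, rfl⟩, by simp⟩
          simp [this]
        · simp
      · have : L.eval (node n i) = 0 := by
          rw [hL, eval_multiset_prod, Multiset.prod_eq_zero_iff]
          simp only [Multiset.mem_map, hA]
          exact ⟨_, ⟨_, ⟨i, by simp; omega, rfl⟩, rfl⟩, by simp⟩
        simp [this]
    have hs : ∑ i ∈ Finset.range n, (if i < j + 1 then (1 : ℝ) else 0) = j + 1 := by
      rw [← Finset.sum_filter, show (Finset.range n).filter (· < j + 1) = Finset.range (j + 1) by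
        ext; simp; omega]
      simp
    rw [Chebyshev.sumZeroes, ← hs, ← Finset.sum_congr rfl hval, mul_div_right_comm]
    rfl

theorem exists_chebyshev_expansion {N : ℕ} {P : ℝ[X]} (hP : P.natDegree ≤ N) :
    ∃ c : ℕ → ℝ, P = ∑ m ∈ Finset.range (N + 1), c m • Chebyshev.T ℝ m := by
  have hmem : P ∈ degreeLT ℝ (N + 1) := by
    rw [mem_degreeLT]
    exact degree_le_natDegree.trans_lt (by exact_mod_cast Nat.lt_succ_of_le hP)
  rw [← Sequence.span_degreeLT (Chebyshev.chebyshevTsequence ℝ) (by simp),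
    show Set.Iio (N + 1) = Finset.range (N + 1) by simp,
    Submodule.mem_span_image_finset_iff_exists_fun'] at hmem
  obtain ⟨c, rfl⟩ := hmem
  exact ⟨c, rfl⟩

theorem integral_eval_mul_T {N : ℕ} (c : ℕ → ℝ) {m : ℕ} (hm : m ∈ Finset.range N) :
    ∫ x, (∑ i ∈ Finset.range N, c i • Chebyshev.T ℝ i).eval x * (Chebyshev.T ℝ m).eval x
      ∂Chebyshev.measureT =
    c m * ∫ x, (Chebyshev.T ℝ m).eval x * (Chebyshev.T ℝ m).eval x ∂Chebyshev.measureT := by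
  simp_rw [eval_finsetSum, eval_smul, smul_eq_mul, Finset.sum_mul, mul_assoc]
  rw [integral_finsetSum]
  · simp_rw [integral_const_mul]
    refine Finset.sum_eq_single_of_mem m hm fun i _ hi => ?_
    rw [Chebyshev.integral_eval_T_real_mul_eval_T_real_measureT_of_ne hi, mul_zero]
  · intro i _
    exact Chebyshev.integrable_measureT (by fun_prop)

/-- The cosine coefficients of a majorant of the indicator of `[0, α]` differ from those of
the indicator by at most the excess of the integral. -/
theorem abs_integral_mul_cos_le {f : ℝ → ℝ} (hf : Continuous f) (h₀ : ∀ θ, 0 ≤ f θ) {α : ℝ}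
    (hα : α ∈ Set.Icc 0 π) (h₁ : ∀ θ ∈ Set.Icc 0 α, 1 ≤ f θ) {m : ℕ} (hm : m ≠ 0) :
    |∫ θ in 0..π, f θ * cos (m * θ)| ≤ (∫ θ in 0..π, f θ) - α + 1 / m := by
  have hm' : (0 : ℝ) < m := by positivity
  have hi : ∀ {g : ℝ → ℝ}, Continuous g → ∀ a b, IntervalIntegrable g volume a b :=
    fun hg a b => hg.intervalIntegrable a b
  have hcos : Continuous fun θ : ℝ => cos (m * θ) := by fun_prop
  have hmul : Continuous fun θ => f θ * cos (m * θ) := by fun_prop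
  have hsplit : ∫ θ in 0..π, f θ * cos (m * θ) =
      (∫ θ in 0..α, (f θ - 1) * cos (m * θ)) + (∫ θ in 0..α, cos (m * θ)) +
        ∫ θ in α..π, f θ * cos (m * θ) := by
    rw [← intervalIntegral.integral_add (hi (by fun_prop) _ _) (hi hcos _ _),
      ← intervalIntegral.integral_add_adjacent_intervals (hi hmul 0 α)
        (hi hmul α π)]
    congr 2
    ext θ
    ring
  have hleft : |∫ θ in 0..α, (f θ - 1) * cos (m * θ)| ≤ (∫ θ in 0..α, f θ) - α := by
    have e : (∫ θ in 0..α, f θ) - α = ∫ θ in 0..α, (f θ - 1) := by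
      rw [intervalIntegral.integral_sub (hi hf _ _) (hi continuous_const _ _)]
      simp
    rw [e]
    refine (intervalIntegral.abs_integral_le_integral_abs hα.1).trans
      (intervalIntegral.integral_mono_on hα.1 (hi (by fun_prop) _ _) (hi (by fun_prop) _ _)
        fun θ hθ => ?_)
    have := sub_nonneg.2 (h₁ θ hθ)
    rw [abs_mul, abs_of_nonneg this]
    exact mul_le_of_le_one_right this (abs_cos_le_one _)
  have hright : |∫ θ in α..π, f θ * cos (m * θ)| ≤ ∫ θ in α..π, f θ := by
    refine (intervalIntegral.abs_integral_le_integral_abs hα.2).trans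
      (intervalIntegral.integral_mono_on hα.2 (hi (by fun_prop) _ _) (hi hf _ _)
        fun θ hθ => ?_)
    rw [abs_mul, abs_of_nonneg (h₀ θ)]
    exact mul_le_of_le_one_right (h₀ θ) (abs_cos_le_one _)
  have hmid : |∫ θ in 0..α, cos (m * θ)| ≤ 1 / m := by
    rw [intervalIntegral.integral_comp_mul_left _ hm'.ne', integral_cos]
    simp only [mul_zero, sin_zero, sub_zero, smul_eq_mul, abs_mul, abs_inv, abs_of_pos hm',
      one_div]
    exact mul_le_of_le_one_right (inv_nonneg.2 hm'.le) (abs_sin_le_one _)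
  rw [hsplit, ← intervalIntegral.integral_add_adjacent_intervals (hi hf 0 α) (hi hf α π)]
  refine (abs_add_three _ _ _).trans ?_
  linarith

/-- A nonnegative majorant of the indicator of `[node n j, ∞)` with controlled Chebyshev
coefficients. -/
theorem exists_majorant_coeff {n j : ℕ} (hj : j < n) :
    ∃ c : ℕ → ℝ,
      (∀ x, 0 ≤ ∑ m ∈ Finset.range (2 * n - 2 + 1), c m * (Chebyshev.T ℝ m).eval x) ∧
      (∀ x, node n j ≤ x →
        1 ≤ ∑ m ∈ Finset.range (2 * n - 2 + 1), c m * (Chebyshev.T ℝ m).eval x) ∧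
      c 0 = (j + 1) / n ∧ ∀ m ∈ Finset.Icc 1 (2 * n - 2), |c m| ≤ 3 / m := by
  obtain ⟨P, hd, h₀, h₁, hs⟩ := exists_majorant hj
  have hn : 0 < n := by omega
  have hn' : (0 : ℝ) < n := by positivity
  have hjn : (j : ℝ) + 1 ≤ n := by exact_mod_cast hj
  have hint : ∫ x, P.eval x ∂Chebyshev.measureT = π * (j + 1) / n := by
    rw [← hs]
    refine Chebyshev.integral_eq_sumZeroes hn.ne' (degree_le_natDegree.trans_lt ?_)
    exact_mod_cast (show P.natDegree < 2 * n by omega)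
  obtain ⟨c, hc⟩ := exists_chebyshev_expansion hd
  have heval : ∀ x, P.eval x =
      ∑ m ∈ Finset.range (2 * n - 2 + 1), c m * (Chebyshev.T ℝ m).eval x := by
    intro x
    rw [hc, eval_finsetSum]
    simp
  refine ⟨c, fun x => heval x ▸ h₀ x, fun x hx => heval x ▸ h₁ x hx, ?_, fun m hm => ?_⟩
  · have h := integral_eval_mul_T c (m := 0) (N := 2 * n - 2 + 1) (by simp)
    rw [← hc] at h
    simp only [Nat.cast_zero, Chebyshev.T_zero, eval_one, mul_one] at h
    have hπ : ∫ _, (1 : ℝ) ∂Chebyshev.measureT = π := by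
      simpa using Chebyshev.integral_eval_T_real_measureT_zero
    rw [hint, hπ] at h
    have := pi_pos
    field_simp at h ⊢
    linarith
  · rw [Finset.mem_Icc] at hm
    have hm' : (0 : ℝ) < m := by exact_mod_cast hm.1
    have hmn : (m : ℝ) ≤ 2 * n := by exact_mod_cast (show m ≤ 2 * n by omega)
    have h := integral_eval_mul_T c (m := m) (N := 2 * n - 2 + 1)
      (Finset.mem_range.2 (by omega))
    rw [← hc, Chebyshev.integral_T_real_mul_self_measureT_of_ne_zero (by omega),
      Chebyshev.integral_measureT_eq_integral_cos] at h
    rw [Chebyshev.integral_measureT_eq_integral_cos] at hint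
    simp_rw [Chebyshev.T_real_cos] at h
    have hα : (2 * j + 1) / (2 * n) * π ∈ Set.Icc 0 π :=
      ⟨by positivity, mul_le_of_le_one_left pi_pos.le
        ((div_le_one (by positivity)).2 (by linarith))⟩
    have hb := abs_integral_mul_cos_le (f := fun θ => P.eval (cos θ)) (by fun_prop)
      (fun θ => h₀ _) hα (fun θ hθ => h₁ _
        (cos_le_cos_of_nonneg_of_le_pi hθ.1 hα.2 hθ.2)) (m := m) (by omega)
    rw [hint] at hb
    push_cast at h
    rw [h, abs_mul, abs_of_pos (show 0 < π / 2 by positivity)] at hb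
    have e : π * (j + 1) / n - (2 * j + 1) / (2 * n) * π = π / (2 * n) := by
      field_simp
      ring
    rw [e] at hb
    have h₂ : π / (2 * n) ≤ π / m := by gcongr
    have h₃ : (1 : ℝ) / m ≤ π / 2 / m := by
      gcongr
      linarith [pi_gt_three]
    have h₄ : |c m| * (π / 2) ≤ 3 / m * (π / 2) := by
      calc _ ≤ π / m + π / 2 / m := by linarith
        _ = _ := by field_simp; norm_num
    exact le_of_mul_le_mul_right h₄ (by positivity)

theorem arcsineMeasure_eq_smul_measureT :
    arcsineMeasure = ENNReal.ofReal π⁻¹ • Chebyshev.measureT := by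
  rw [arcsineMeasure, Chebyshev.measureT, restrict_withDensity measurableSet_Ioc,
    ← restrict_Ioo_eq_restrict_Ioc, ← withDensity_indicator measurableSet_Ioo,
    ← withDensity_smul _ ((by fun_prop : Measurable _).indicator measurableSet_Ioo)]
  congr 1
  ext x
  by_cases hx : x ∈ Set.Ioo (-1 : ℝ) 1
  · simp only [Set.indicator_of_mem hx, Pi.smul_apply, smul_eq_mul]
    rw [mul_inv, ENNReal.ofReal_mul (inv_nonneg.2 pi_pos.le), ← sqrt_inv]
    congr 1
    exact ENNReal.ofReal_eq_coe_nnreal _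
  · simp [Set.indicator_of_notMem hx]

theorem arcsineMeasure_Ici (x : ℝ) : (arcsineMeasure (Set.Ici x)).toReal = arccos x / π := by
  have hT : Chebyshev.measureT.real (Set.Ici x) = arccos x := by
    rw [← integral_indicator_one measurableSet_Ici, Chebyshev.integral_measureT_eq_integral_cos]
    have hcongr : ∫ θ in 0..π, (Set.Ici x).indicator (1 : ℝ → ℝ) (cos θ) =
        ∫ θ in 0..π, {θ | θ ≤ arccos x}.indicator (fun _ => (1 : ℝ)) θ := by
      refine intervalIntegral.integral_congr_ae (.of_forall fun θ hθ => ?_)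
      rw [Set.uIoc_of_le pi_pos.le] at hθ
      have : x ≤ cos θ ↔ θ ≤ arccos x := by
        constructor
        · intro h
          simpa [arccos_cos hθ.1.le hθ.2] using arccos_le_arccos h
        · intro h
          rcases le_total x (-1) with hx | hx
          · exact hx.trans (neg_one_le_cos θ)
          · have hx₁ : x < 1 := arccos_pos.1 (hθ.1.trans_le h)
            simpa [cos_arccos hx hx₁.le] using
              cos_le_cos_of_nonneg_of_le_pi hθ.1.le (arccos_le_pi x) h
      simp [Set.indicator_apply, this]
    rw [hcongr, intervalIntegral.integral_indicator ⟨arccos_nonneg x, arccos_le_pi x⟩]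
    simp
  rw [arcsineMeasure_eq_smul_measureT, Measure.smul_apply, smul_eq_mul, ENNReal.toReal_mul,
    ← Measure.real, hT, ENNReal.toReal_ofReal (inv_nonneg.2 pi_pos.le), mul_comm, div_eq_mul_inv]

/-- The upper half of the Erdős–Turán inequality. -/
theorem measure_Ici_le (μ : Measure ℝ) [IsProbabilityMeasure μ]
    (hμ : ∀ n : ℕ, Integrable (fun x => (Chebyshev.T ℝ n).eval x) μ) {N : ℕ} (hN : 1 ≤ N)
    (x₀ : ℝ) :
    (μ (Set.Ici x₀)).toReal ≤ arccos x₀ / π +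
      4 * (1 / N + ∑ n ∈ Finset.Icc 1 N, (1 / n) * |∫ x, (Chebyshev.T ℝ n).eval x ∂μ|) := by
  set n := N / 2 + 1 with hn
  have hn' : (0 : ℝ) < n := by positivity
  have hN' : (0 : ℝ) < N := by positivity
  have hNn : (2 : ℝ) / n ≤ 4 * (1 / N) := by
    have : (N : ℝ) ≤ 2 * n := by exact_mod_cast (show N ≤ 2 * n by omega)
    rw [mul_one_div, div_le_div_iff₀ hn' hN']
    linarith
  have hS : 0 ≤ ∑ n ∈ Finset.Icc 1 N, (1 / (n : ℝ)) * |∫ x, (Chebyshev.T ℝ n).eval x ∂μ| :=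
    Finset.sum_nonneg fun i _ => by positivity
  have hs₀ : 0 ≤ n * (arccos x₀ / π) :=
    mul_nonneg hn'.le (div_nonneg (arccos_nonneg _) pi_pos.le)
  set j := ⌈n * (arccos x₀ / π)⌉₊ with hj
  have hj₁ : n * (arccos x₀ / π) ≤ j := Nat.le_ceil _
  have hj₂ : ((j : ℝ) + 1) / n ≤ arccos x₀ / π + 2 / n := by
    have : (j : ℝ) < n * (arccos x₀ / π) + 1 := Nat.ceil_lt_add_one hs₀
    rw [div_le_iff₀ hn', add_mul, div_mul_cancel₀ _ hn'.ne']
    linarith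
  rcases lt_or_ge j n with hjn | hjn
  · obtain ⟨c, h₀, h₁, hc₀, hc⟩ := exists_majorant_coeff hjn
    have hnode : node n j ≤ x₀ := by
      have hx : -1 < x₀ := by
        by_contra! hx
        rw [arccos_of_le_neg_one hx, div_self pi_ne_zero, mul_one] at hj₁
        have : n ≤ j := by exact_mod_cast hj₁
        omega
      have hle : arccos x₀ ≤ (2 * j + 1) / (2 * n) * π := by
        rw [← div_le_iff₀ pi_pos, le_div_iff₀ (by positivity)]
        linarith
      have hcos : cos (arccos x₀) ≤ x₀ := by
        rcases le_total x₀ 1 with h | h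
        · exact (cos_arccos hx.le h).le
        · exact (cos_le_one _).trans h
      refine le_trans (cos_le_cos_of_nonneg_of_le_pi (arccos_nonneg _) ?_ hle) hcos
      have : (j : ℝ) + 1 ≤ n := by exact_mod_cast hjn
      exact mul_le_of_le_one_left pi_pos.le ((div_le_one (by positivity)).2 (by linarith))
    have hint : Integrable (fun x => ∑ m ∈ Finset.range (2 * n - 2 + 1),
        c m * (Chebyshev.T ℝ m).eval x) μ :=
      integrable_finsetSum _ fun m _ => (hμ m).const_mul _
    have hμle : (μ (Set.Ici x₀)).toReal ≤ ∫ x, ∑ m ∈ Finset.range (2 * n - 2 + 1),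
        c m * (Chebyshev.T ℝ m).eval x ∂μ := by
      have e := integral_indicator_one (μ := μ) (measurableSet_Ici (a := x₀))
      rw [← Measure.real, ← e]
      refine integral_mono ((integrable_const 1).indicator measurableSet_Ici) hint fun x => ?_
      by_cases hx : x ∈ Set.Ici x₀
      · simpa [Set.indicator_of_mem hx] using h₁ x (hnode.trans hx)
      · simpa [Set.indicator_of_notMem hx] using h₀ x
    have hexp : ∫ x, ∑ m ∈ Finset.range (2 * n - 2 + 1), c m * (Chebyshev.T ℝ m).eval x ∂μ =
        (j + 1) / n +
          ∑ m ∈ Finset.Icc 1 (2 * n - 2), c m * ∫ x, (Chebyshev.T ℝ m).eval x ∂μ := by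
      rw [integral_finsetSum _ fun m _ => (hμ m).const_mul _]
      simp_rw [integral_const_mul]
      rw [Finset.range_eq_Ico, Finset.sum_eq_sum_Ico_succ_bot (by omega), hc₀]
      simp
      rfl
    have hsum : ∑ m ∈ Finset.Icc 1 (2 * n - 2), c m * ∫ x, (Chebyshev.T ℝ m).eval x ∂μ ≤
        4 * ∑ n ∈ Finset.Icc 1 N, (1 / (n : ℝ)) * |∫ x, (Chebyshev.T ℝ n).eval x ∂μ| := by
      rw [Finset.mul_sum]
      refine (Finset.sum_le_sum fun m hm => ?_).trans
        (Finset.sum_le_sum_of_subset_of_nonneg (Finset.Icc_subset_Icc_right (by omega))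
          fun i _ _ => by positivity)
      calc _ ≤ |c m| * |∫ x, (Chebyshev.T ℝ m).eval x ∂μ| := by
            rw [← abs_mul]; exact le_abs_self _
        _ ≤ 3 / m * |∫ x, (Chebyshev.T ℝ m).eval x ∂μ| := by gcongr; exact hc m hm
        _ ≤ 4 / m * |∫ x, (Chebyshev.T ℝ m).eval x ∂μ| := by gcongr; norm_num
        _ = _ := by ring
    rw [hexp] at hμle
    linarith
  · have : (μ (Set.Ici x₀)).toReal ≤ 1 := measureReal_le_one
    have : (1 : ℝ) ≤ (j + 1) / n := by
      rw [le_div_iff₀ hn']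
      have : (n : ℝ) ≤ j := by exact_mod_cast hjn
      linarith
    linarith

end ErdosTuran

/-- **Erdős–Turán inequality, real-line form.** There is a universal constant `K > 0`
such that for every probability measure `μ` on `ℝ` (whose Chebyshev moments exist),
every `n₀ ≥ 1` and every `x₀ ∈ ℝ`,
`|μ[x₀,∞) - σ₁[x₀,∞)| ≤ K (1/n₀ + ∑_{n=1}^{n₀} |∫ Tₙ dμ|/n)`. -/
theorem erdos_turan_real :
    ∃ K : ℝ, 0 < K ∧
      ∀ (μ : Measure ℝ), IsProbabilityMeasure μ →
        (∀ n : ℕ, Integrable (fun x => (Polynomial.Chebyshev.T ℝ n).eval x) μ) →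
        ∀ n₀ : ℕ, 1 ≤ n₀ → ∀ x₀ : ℝ,
          |(μ (Set.Ici x₀)).toReal - (arcsineMeasure (Set.Ici x₀)).toReal|
            ≤ K * (1 / n₀ + ∑ n ∈ Finset.Icc 1 n₀,
                (1 / n) * |∫ x, (Polynomial.Chebyshev.T ℝ n).eval x ∂μ|) := by
  refine ⟨4, by norm_num, fun μ _ hμ N hN x₀ => ?_⟩
  rw [ErdosTuran.arcsineMeasure_Ici]
  have hup := ErdosTuran.measure_Ici_le μ hμ hN x₀
  have hemb : MeasurableEmbedding (fun x : ℝ => -x) := (MeasurableEquiv.neg ℝ).measurableEmbedding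
  have : IsProbabilityMeasure (μ.map fun x => -x) :=
    Measure.isProbabilityMeasure_map measurable_neg.aemeasurable
  have hlow := ErdosTuran.measure_Ici_le (μ.map fun x => -x)
    (fun n => by
      rw [hemb.integrable_map_iff]
      simpa only [Function.comp_def, Chebyshev.T_eval_neg] using (hμ n).const_mul _)
    hN (-x₀)
  have hmom : ∀ n : ℕ, |∫ x, (Chebyshev.T ℝ n).eval x ∂(μ.map fun x => -x)| =
      |∫ x, (Chebyshev.T ℝ n).eval x ∂μ| := by
    intro n
    rw [hemb.integral_map]
    simp_rw [Chebyshev.T_eval_neg]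
    rw [integral_const_mul, abs_mul]
    rcases Int.even_or_odd (n : ℤ) with h | h
    · simp [Int.negOnePow_even _ h]
    · simp [Int.negOnePow_odd _ h]
  simp_rw [hmom] at hlow
  have hpre : (fun x : ℝ => -x) ⁻¹' Set.Ici (-x₀) = Set.Iic x₀ := by ext; simp
  rw [hemb.map_apply, hpre, arccos_neg, sub_div, div_self pi_ne_zero] at hlow
  have hcover : 1 ≤ (μ (Set.Ici x₀)).toReal + (μ (Set.Iic x₀)).toReal := by
    have h := measureReal_union_le (μ := μ) (Set.Ici x₀) (Set.Iic x₀)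
    rw [Set.union_comm, Set.Iic_union_Ici, probReal_univ] at h
    exact h
  rw [abs_le]
  constructor <;> linarith
end

section
/- There is a universal constant C such that for every n₀ ≥ 1, every zero x₀ = cos θ₀ of T_{n₀} with 0 < θ₀ ≤ π/2, and every 1 ≤ n ≤ 2n₀, one has ∫_ℝ R²(x)|T_n(x)| dσ₁(x) ≤ C/n₀, where R(x) = T_{n₀}(x)/(T_{n₀}'(x₀)(x - x₀)). -/
open MeasureTheory Polynomial Real

open Polynomial.Chebyshev

/-- The arcsine measure is `π⁻¹` times the Chebyshev measure of Mathlib. -/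
lemma integral_arcsineMeasure (f : ℝ → ℝ) :
    ∫ x, f x ∂arcsineMeasure = π⁻¹ * ∫ x, f x ∂measureT := by
  have hmeas : Measurable (Set.indicator (Set.Ioo (-1 : ℝ) 1)
      (fun x => (π * Real.sqrt (1 - x ^ 2))⁻¹)) :=
    Measurable.indicator (by fun_prop) measurableSet_Ioo
  rw [arcsineMeasure, integral_withDensity_eq_integral_toReal_smul hmeas.ennreal_ofReal
    (by simp), integral_measureT, intervalIntegral.integral_of_le (by norm_num),
    integral_Ioc_eq_integral_Ioo, ← integral_const_mul, ← integral_indicator measurableSet_Ioo]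
  refine integral_congr_ae (.of_forall fun x => ?_)
  by_cases hx : x ∈ Set.Ioo (-1 : ℝ) 1
  · have h : (0 : ℝ) ≤ (π * Real.sqrt (1 - x ^ 2))⁻¹ := by positivity
    simp only [Set.indicator_of_mem hx]
    rw [ENNReal.toReal_ofReal h, smul_eq_mul, mul_inv, Real.sqrt_inv]
    ring
  · simp [Set.indicator_of_notMem hx]

lemma ae_measureT_mem_Ioc : ∀ᵐ x ∂measureT, x ∈ Set.Ioc (-1 : ℝ) 1 :=
  ae_restrict_mem measurableSet_Ioc

/-- A polynomial which vanishes at all the Chebyshev nodes except `x₀`, where its value is at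
most `1`, has Chebyshev–Gauss sum at most `π / n`. -/
lemma sumZeroes_le_pi_div {n : ℕ} {x₀ : ℝ} {P : ℝ[X]} (h₀ : P.eval x₀ ≤ 1)
    (h : ∀ x, (T ℝ n).eval x = 0 → x ≠ x₀ → P.eval x = 0) : sumZeroes n P ≤ π / n := by
  rcases eq_or_ne n 0 with rfl | hn
  · simp [sumZeroes]
  have hinj := Multiset.inj_on_of_nodup_map (roots_T_real_nodup n)
  have hroot : ∀ k ∈ Finset.range n, (T ℝ n).eval (cos ((2 * k + 1) * π / (2 * n))) = 0 := by
    intro k hk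
    have hmem : cos ((2 * k + 1) * π / (2 * n)) ∈ (T ℝ n).roots := by
      rw [roots_T_real, Finset.mem_val]
      exact Finset.mem_image.mpr ⟨k, hk, rfl⟩
    exact isRoot_of_mem_roots hmem
  have hle : ∑ k ∈ Finset.range n, P.eval (cos ((2 * k + 1) / (2 * n) * π)) ≤ 1 := by
    simp_rw [div_mul_eq_mul_div]
    by_cases hk : ∃ k ∈ Finset.range n, cos ((2 * (k : ℝ) + 1) * π / (2 * n)) = x₀
    · obtain ⟨k, hk, rfl⟩ := hk
      rw [Finset.sum_eq_single_of_mem k hk fun j hj hjk =>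
        h _ (hroot j hj) fun e => hjk (hinj j (by simpa using hj) k (by simpa using hk) e)]
      exact h₀
    · push Not at hk
      rw [Finset.sum_eq_zero fun j hj => h _ (hroot j hj) (hk j hj)]
      exact zero_le_one
  exact mul_le_of_le_one_right (by positivity) hle

/-- There is a universal constant `C` such that for every `n₀ ≥ 1`, every zero
`x₀ = cos θ₀` of `T n₀` with `0 < θ₀ ≤ π/2`, and every `1 ≤ n ≤ 2n₀`, one has
`∫ R(x)² |Tₙ(x)| dσ₁(x) ≤ C/n₀`, where `R(x) = T n₀(x)/(T n₀'(x₀)(x-x₀))`. -/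
theorem arcsine_lagrange_sq_mul_chebyshev_bound :
    ∃ C : ℝ, 0 < C ∧
      ∀ n₀ : ℕ, 1 ≤ n₀ → ∀ θ₀ : ℝ, 0 < θ₀ → θ₀ ≤ π / 2 →
        (Polynomial.Chebyshev.T ℝ n₀).eval (Real.cos θ₀) = 0 →
        ∀ n : ℕ, 1 ≤ n → n ≤ 2 * n₀ →
          ∫ x, ((Polynomial.Chebyshev.T ℝ n₀).eval x
              / ((Polynomial.derivative (Polynomial.Chebyshev.T ℝ n₀)).eval (Real.cos θ₀)
                  * (x - Real.cos θ₀))) ^ 2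
            * |(Polynomial.Chebyshev.T ℝ n).eval x| ∂arcsineMeasure
          ≤ C / n₀ := by
  refine ⟨1, one_pos, fun n₀ hn₀ θ₀ _ _ hroot n _ _ => ?_⟩
  set x₀ := Real.cos θ₀
  obtain ⟨Q, hQ⟩ := dvd_iff_isRoot.mpr hroot
  have hderiv : (derivative (T ℝ n₀)).eval x₀ = Q.eval x₀ := by simp [hQ]
  have hdeg : Q.natDegree < n₀ := by
    have hQ₀ : Q ≠ 0 := by
      rintro rfl
      exact T_ne_zero ℝ n₀ (by simpa using hQ)
    have h := natDegree_T ℝ n₀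
    rw [hQ, natDegree_mul (X_sub_C_ne_zero x₀) hQ₀, natDegree_X_sub_C, Int.natAbs_natCast] at h
    omega
  rw [hderiv]
  set P : ℝ[X] := (C (Q.eval x₀)⁻¹ * Q) ^ 2 with hP
  have hPdeg : P.degree < 2 * n₀ := by
    have hle : P.natDegree ≤ 2 * Q.natDegree :=
      natDegree_pow_le_of_le 2 (natDegree_C_mul_le _ _)
    refine degree_le_natDegree.trans_lt ?_
    exact_mod_cast (by omega : P.natDegree < 2 * n₀)
  have hPeval (x : ℝ) : P.eval x = ((Q.eval x₀)⁻¹ * Q.eval x) ^ 2 := by simp [hP]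
  have hsum : sumZeroes n₀ P ≤ π / n₀ := by
    refine sumZeroes_le_pi_div (x₀ := x₀) ?_ fun x hx hne => ?_
    · rcases eq_or_ne (Q.eval x₀) 0 with h | h <;> simp [hPeval, h]
    · have : Q.eval x = 0 := by simpa [hQ, sub_ne_zero.mpr hne] using hx
      simp [hPeval, this]
  have hmono : ∫ x, ((T ℝ n₀).eval x / (Q.eval x₀ * (x - x₀))) ^ 2 * |(T ℝ n).eval x| ∂measureT
      ≤ ∫ x, P.eval x ∂measureT := by
    refine integral_mono_of_nonneg (.of_forall fun x => by positivity)
      (integrable_measureT (by fun_prop)) ?_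
    filter_upwards [ae_measureT_mem_Ioc] with x hx
    refine (mul_le_of_le_one_right (sq_nonneg _)
      (abs_eval_T_real_le_one n (abs_le.mpr ⟨hx.1.le, hx.2⟩))).trans ?_
    rw [hPeval]
    rcases eq_or_ne x x₀ with rfl | hne
    · simpa using sq_nonneg _
    · have hne' := sub_ne_zero.mpr hne
      refine le_of_eq ?_
      rw [hQ, eval_mul, eval_sub, eval_X, eval_C, mul_comm (Q.eval x₀),
        mul_div_mul_left _ _ hne', div_eq_inv_mul]
  rw [integral_arcsineMeasure]
  rw [integral_eq_sumZeroes (by omega) hPdeg] at hmono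
  calc _ ≤ π⁻¹ * (π / n₀) := by gcongr; exact hmono.trans hsum
    _ = 1 / n₀ := by field_simp
end
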